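/- Let f : U → ℝ be smooth on an open neighborhood U of 0 in ℝ², with f(0)=0, ∇f(0)=0, and let φ be a smooth compactly supported function in U with φ(0) > 0 and φ ≥ 0 on U. Let c₀(f) be the critical integrability index of f. Then Z_f(φ)(s) = ∫ |f|^s φ dx dy, which is holomorphic on Re(s) > -c₀(f), cannot be holomorphically continued to any open neighborhood of the point s = -c₀(f). -/

import Mathlib

open Real Filter Set Topology MeasureTheory Complex

open ProbabilityTheory in
/-- A Landau / Pringsheim type lemma for moment generating functions of nonnegative variables. -/
lemma landau_mgf {Ω : Type*} [MeasurableSpace Ω] (ν : Measure Ω) [IsFiniteMeasure ν]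
    (hν : ν ≠ 0) (L : Ω → ℝ) (hL : Measurable L) (hL0 : ∀ᵐ x ∂ν, 0 ≤ L x)
    (c : ℝ) (hc : 0 < c) (W : Set ℂ) (G : ℂ → ℂ) (hW : IsOpen W) (hcW : (c : ℂ) ∈ W)
    (hG : DifferentiableOn ℂ G (W ∪ {z : ℂ | z.re < c}))
    (hGeq : ∀ z : ℂ, z ≠ 0 → z.re < c → G z = complexMGF L ν z) :
    ∃ t : ℝ, c < t ∧ t ∈ integrableExpSet L ν := by
  have hmono : ∀ s t : ℝ, s ≤ t → t ∈ integrableExpSet L ν → s ∈ integrableExpSet L ν := by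
    intro s t hst ht
    have ht' : Integrable (fun x => rexp (t * L x)) ν := ht
    refine Integrable.mono' ht' (by fun_prop) ?_
    filter_upwards [hL0] with x hx
    rw [Real.norm_eq_abs, abs_of_pos (Real.exp_pos _)]
    gcongr
  have h0 : (0 : ℝ) ∈ integrableExpSet L ν := by
    simp [integrableExpSet]
  have hopen : IsOpen {z : ℂ | z.re < c} := isOpen_lt Complex.continuous_re continuous_const
  -- all t < c are in the set
  have hall : ∀ t < c, t ∈ integrableExpSet L ν := by
    by_contra hcon
    push Not at hcon
    obtain ⟨t0, ht0c, ht0⟩ := hcon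
    have ht00 : 0 < t0 := by
      by_contra h
      exact ht0 (hmono _ _ (not_lt.mp h) h0)
    have hGan : AnalyticOnNhd ℂ G {z : ℂ | z.re < c} :=
      (hG.mono subset_union_right).analyticOnNhd hopen
    have hconv : Convex ℝ {z : ℂ | z.re < c} := convex_halfSpace_re_lt c
    have hz0 : (((t0 + c) / 2 : ℝ) : ℂ) ∈ {z : ℂ | z.re < c} := by
      simp only [mem_ofPred_eq, ofReal_re]; linarith
    have hev : G =ᶠ[𝓝 (((t0 + c) / 2 : ℝ) : ℂ)] 0 := by
      have h1 : ∀ᶠ z : ℂ in 𝓝 (((t0 + c) / 2 : ℝ) : ℂ), z.re < c := hopen.mem_nhds hz0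
      have h2 : ∀ᶠ z : ℂ in 𝓝 (((t0 + c) / 2 : ℝ) : ℂ), t0 < z.re := by
        apply (isOpen_lt continuous_const Complex.continuous_re).mem_nhds
        simp only [mem_ofPred_eq, ofReal_re]; linarith
      filter_upwards [h1, h2] with z hz1 hz2
      rw [hGeq z (by rintro rfl; simp at hz2; linarith) hz1,
        complexMGF_undef hL.aemeasurable]
      · rfl
      · intro hint
        exact ht0 (hmono _ _ hz2.le hint)
    have hzero := hGan.eqOn_zero_of_preconnected_of_eventuallyEq_zero
      hconv.isPreconnected hz0 hev
    have hm1 : (((-1 : ℝ)) : ℂ) ∈ {z : ℂ | z.re < c} := by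
      simp only [mem_ofPred_eq, ofReal_re]; linarith
    have h3 := hzero hm1
    rw [hGeq _ (by norm_num) hm1, complexMGF_ofReal] at h3
    have h4 : 0 < mgf L ν (-1) := mgf_pos' hν (hmono (-1) 0 (by norm_num) h0)
    have h5 : mgf L ν (-1) = 0 := Complex.ofReal_eq_zero.mp h3
    linarith
  -- choose radius
  obtain ⟨ε, hε, hball⟩ := Metric.isOpen_iff.mp hW _ hcW
  obtain ⟨δ, hδ, hδε, hδc⟩ : ∃ δ : ℝ, 0 < δ ∧ 4 * δ ≤ ε ∧ δ < c := by
    refine ⟨min (ε / 4) (c / 2), by positivity, ?_, ?_⟩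
    · have := min_le_left (ε / 4) (c / 2); linarith
    · have := min_le_right (ε / 4) (c / 2); linarith
  set a : ℝ := c - δ with ha
  have haint : ((a : ℂ)).re ∈ interior (integrableExpSet L ν) := by
    rw [mem_interior]
    refine ⟨Iio c, fun t ht => hall t ht, isOpen_Iio, ?_⟩
    simp [ha, hδ]
  have hGball : DifferentiableOn ℂ G (Metric.ball (a : ℂ) (3 * δ)) := by
    refine hG.mono (Subset.trans ?_ subset_union_left)
    refine Subset.trans ?_ hball
    apply Metric.ball_subset_ball'
    rw [Complex.dist_eq, ← ofReal_sub, norm_real, Real.norm_eq_abs, ha]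
    rw [show c - δ - c = -δ by ring, abs_neg, abs_of_pos hδ]
    linarith
  have hGev : G =ᶠ[𝓝 (a : ℂ)] complexMGF L ν := by
    have h1 : ∀ᶠ z : ℂ in 𝓝 (a : ℂ), z.re < c := hopen.mem_nhds (by simp [ha, hδ])
    have h2 : ∀ᶠ z : ℂ in 𝓝 (a : ℂ), 0 < z.re := by
      apply (isOpen_lt continuous_const Complex.continuous_re).mem_nhds
      simp only [mem_ofPred_eq, ofReal_re]; linarith
    filter_upwards [h1, h2] with z hz1 hz2
    exact hGeq z (by rintro rfl; simp at hz2) hz1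
  have hz : ((a + 2 * δ : ℝ) : ℂ) ∈ Metric.ball (a : ℂ) (3 * δ) := by
    rw [Metric.mem_ball, Complex.dist_eq, ← ofReal_sub, norm_real, Real.norm_eq_abs]
    rw [show a + 2 * δ - a = 2 * δ by ring, abs_of_pos (by positivity)]
    linarith
  have hsum := (Complex.hasSum_taylorSeries_on_ball hGball hz).summable
  have hterm : ∀ n : ℕ, ((n.factorial : ℂ)⁻¹ • (((a + 2 * δ : ℝ) : ℂ) - (a : ℂ)) ^ n •
      iteratedDeriv n G (a : ℂ)) =
      ((∫ x, (n.factorial : ℝ)⁻¹ * ((2 * δ) ^ n * (L x ^ n * rexp (a * L x))) ∂ν : ℝ) : ℂ) := by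
    intro n
    rw [hGev.iteratedDeriv_eq n, iteratedDeriv_complexMGF haint,
      integral_const_mul, integral_const_mul]
    have : ∫ x, ((L x : ℂ)) ^ n * cexp ((a : ℂ) * L x) ∂ν =
        ((∫ x, L x ^ n * rexp (a * L x) ∂ν : ℝ) : ℂ) := by
      rw [← integral_complex_ofReal]
      congr 1
      ext x
      push_cast
      rfl
    rw [this]
    push_cast
    simp only [smul_eq_mul]
    ring
  simp_rw [hterm] at hsum
  have hsumR := Complex.summable_ofReal.mp hsum
  refine ⟨a + 2 * δ, by linarith, ?_⟩
  have hint : ∀ n : ℕ, Integrable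
      (fun x => (n.factorial : ℝ)⁻¹ * ((2 * δ) ^ n * (L x ^ n * rexp (a * L x)))) ν := by
    intro n
    exact ((integrable_pow_mul_exp_of_mem_interior_integrableExpSet haint n).const_mul _).const_mul _
  have hnn : ∀ n : ℕ, 0 ≤ᵐ[ν]
      (fun x => (n.factorial : ℝ)⁻¹ * ((2 * δ) ^ n * (L x ^ n * rexp (a * L x)))) := by
    intro n
    filter_upwards [hL0] with x hx
    simp only [Pi.zero_apply]
    positivity
  change Integrable (fun x => rexp ((a + 2 * δ) * L x)) ν
  refine ⟨by fun_prop, ?_⟩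
  rw [hasFiniteIntegral_iff_ofReal (ae_of_all _ fun x => (Real.exp_pos _).le)]
  have hexp : ∀ᵐ x ∂ν, ENNReal.ofReal (rexp ((a + 2 * δ) * L x)) = ∑' n : ℕ, ENNReal.ofReal
      ((n.factorial : ℝ)⁻¹ * ((2 * δ) ^ n * (L x ^ n * rexp (a * L x)))) := by
    have := ae_all_iff.mpr hnn
    filter_upwards [this] with x hx
    have hs : HasSum (fun n : ℕ => (n.factorial : ℝ)⁻¹ * ((2 * δ) ^ n * (L x ^ n * rexp (a * L x))))
        (rexp ((a + 2 * δ) * L x)) := by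
      have h1 := (NormedSpace.expSeries_div_hasSum_exp (2 * δ * L x)).mul_right (rexp (a * L x))
      rw [← Real.exp_eq_exp_ℝ, ← Real.exp_add] at h1
      rw [show 2 * δ * L x + a * L x = (a + 2 * δ) * L x by ring] at h1
      have h2 : (fun n : ℕ => (n.factorial : ℝ)⁻¹ * ((2 * δ) ^ n * (L x ^ n * rexp (a * L x)))) =
          fun n : ℕ => (2 * δ * L x) ^ n / (n.factorial : ℝ) * rexp (a * L x) := by
        funext n
        rw [mul_pow (2 * δ) (L x) n]
        ring
      rw [h2]
      exact h1
    rw [← hs.tsum_eq, ENNReal.ofReal_tsum_of_nonneg hx hs.summable]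
  rw [lintegral_congr_ae hexp, lintegral_tsum (fun n => by fun_prop)]
  have h6 : ∀ n : ℕ, ∫⁻ x, ENNReal.ofReal
      ((n.factorial : ℝ)⁻¹ * ((2 * δ) ^ n * (L x ^ n * rexp (a * L x)))) ∂ν =
      ENNReal.ofReal (∫ x, (n.factorial : ℝ)⁻¹ * ((2 * δ) ^ n * (L x ^ n * rexp (a * L x))) ∂ν) :=
    fun n => (ofReal_integral_eq_lintegral_ofReal (hint n) (hnn n)).symm
  simp_rw [h6]
  rw [← ENNReal.ofReal_tsum_of_nonneg (fun n => integral_nonneg_of_ae (hnn n)) hsumR]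
  exact ENNReal.ofReal_lt_top

open ProbabilityTheory in
theorem no_holomorphic_continuation_at_neg_c₀
    (f φ : ℝ × ℝ → ℝ) (U : Set (ℝ × ℝ))
    (hU : IsOpen U) (hU0 : (0 : ℝ × ℝ) ∈ U)
    (hf : ContDiffOn ℝ (⊤ : ℕ∞) f U) (hf0 : f 0 = 0)
    (hdf0 : fderiv ℝ f 0 = 0)
    (hφ : ContDiff ℝ (⊤ : ℕ∞) φ) (hφc : HasCompactSupport φ)
    (hφsupp : tsupport φ ⊆ U)
    (hφ0 : 0 < φ 0) (hφnn : ∀ x ∈ U, 0 ≤ φ x)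
    (hf1 : ∀ x ∈ tsupport φ, |f x| < 1)
    (c₀ : ℝ)
    (hc₀ : c₀ = sSup {μ : ℝ | 0 < μ ∧ ∃ V : Set (ℝ × ℝ), IsOpen V ∧ (0 : ℝ × ℝ) ∈ V ∧
        V ⊆ U ∧ IntegrableOn (fun x => |f x| ^ (-μ)) V})
    (hc₀pos : 0 < c₀) :
    ¬ ∃ (W : Set ℂ) (g : ℂ → ℂ), IsOpen W ∧ ((-c₀ : ℝ) : ℂ) ∈ W ∧
        DifferentiableOn ℂ g (W ∪ {s : ℂ | -c₀ < s.re}) ∧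
        ∀ s : ℂ, -c₀ < s.re →
          g s = ∫ x, ((|f x| : ℝ) : ℂ) ^ s * (φ x : ℂ) := by
  classical
  rintro ⟨W, g, hW, hcW, hg, hgeq⟩
  set S := {μ : ℝ | 0 < μ ∧ ∃ V : Set (ℝ × ℝ), IsOpen V ∧ (0 : ℝ × ℝ) ∈ V ∧
        V ⊆ U ∧ IntegrableOn (fun x => |f x| ^ (-μ)) V} with hS
  have hSb : BddAbove S := by
    by_contra h
    rw [Real.sSup_of_not_bddAbove h] at hc₀
    linarith
  have hφcont : Continuous φ := hφ.continuous
  have hφm : Measurable φ := hφcont.measurable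
  have hφU : ∀ x, x ∉ U → φ x = 0 := fun x hx => image_eq_zero_of_notMem_tsupport
    fun h => hx (hφsupp h)
  have hφpos : ∀ x, 0 ≤ φ x := fun x => by
    by_cases hx : x ∈ U
    · exact hφnn x hx
    · rw [hφU x hx]
  have hφlt : ∀ x, φ x ≠ 0 → |f x| < 1 := fun x hx => hf1 x (subset_tsupport _ hx)
  set F : ℝ × ℝ → ℝ := U.piecewise f (fun _ => 0) with hF
  have hFm : Measurable F :=
    hf.continuousOn.measurable_piecewise continuousOn_const hU.measurableSet
  have hFU : ∀ x ∈ U, F x = f x := fun x hx => by simp [hF, hx]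
  set A : Set (ℝ × ℝ) := {x | F x ≠ 0} with hA
  have hAm : MeasurableSet A := (hFm (measurableSet_singleton 0)).compl
  set L : ℝ × ℝ → ℝ := fun x => -Real.log |F x| with hL
  have hLm : Measurable L := by
    simp only [hL, Real.log_abs]
    exact (Real.measurable_log.comp hFm).neg
  have hρm : Measurable (fun x => (φ x).toNNReal) := hφm.real_toNNReal
  set ν : Measure (ℝ × ℝ) := (volume.restrict A).withDensity
    (fun x => ((φ x).toNNReal : ENNReal)) with hν
  have hφint : Integrable φ := hφcont.integrable_of_hasCompactSupport hφc
  have : IsFiniteMeasure ν := by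
    refine isFiniteMeasure_withDensity_ofReal (f := φ) ?_
    exact hφint.integrableOn.2
  have hL0 : ∀ᵐ x ∂ν, 0 ≤ L x := by
    rw [hν, ae_withDensity_iff (by fun_prop)]
    refine ae_of_all _ fun x hx => ?_
    have hx' : φ x ≠ 0 := by
      intro h
      simp [h] at hx
    have hxU : x ∈ U := by
      by_contra h
      exact hx' (hφU x h)
    simp only [hL, hFU x hxU]
    have := Real.log_nonpos (abs_nonneg (f x)) (hφlt x hx').le
    linarith
  -- membership in S
  have hmem : ∀ t : ℝ, 0 < t → t ∈ integrableExpSet L ν → t ∈ S := by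
    intro t ht hti
    have hti' : Integrable (fun x => rexp (t * L x)) ν := hti
    rw [hν, integrable_withDensity_iff_integrable_smul hρm] at hti'
    refine ⟨ht, U ∩ {x | φ 0 / 2 < φ x}, hU.inter (isOpen_lt continuous_const hφcont),
      ⟨hU0, by simp only [mem_ofPred_eq]; linarith⟩, inter_subset_left, ?_⟩
    set V := U ∩ {x | φ 0 / 2 < φ x} with hV
    have hVm : MeasurableSet V := (hU.inter (isOpen_lt continuous_const hφcont)).measurableSet
    have hcongr : EqOn (fun x => |F x| ^ (-t)) (fun x => |f x| ^ (-t)) V := by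
      intro x hx
      simp only [hFU x hx.1]
    refine IntegrableOn.congr_fun ?_ hcongr hVm
    have hI : Integrable (fun x => (2 / φ 0) *
        A.indicator (fun x => (φ x).toNNReal • rexp (t * L x)) x) :=
      ((integrable_indicator_iff hAm).mpr hti').const_mul _
    refine Integrable.mono' hI.integrableOn (hFm.abs.pow_const _).aestronglyMeasurable ?_
    refine (ae_restrict_iff' hVm).mpr (ae_of_all _ fun x hx => ?_)
    rw [Real.norm_eq_abs, abs_of_nonneg (by positivity)]
    by_cases hxA : x ∈ A
    · rw [indicator_of_mem hxA, NNReal.smul_def, Real.coe_toNNReal _ (hφpos x), smul_eq_mul]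
      have hFx : 0 < |F x| := abs_pos.mpr hxA
      have : |F x| ^ (-t) = rexp (t * L x) := by
        rw [Real.rpow_def_of_pos hFx]
        congr 1
        simp only [hL]; ring
      rw [this]
      have h2 : φ 0 / 2 < φ x := hx.2
      have h3 : 1 ≤ 2 / φ 0 * φ x := by
        rw [div_mul_eq_mul_div, le_div_iff₀ hφ0]; linarith
      rw [← mul_assoc]
      exact le_mul_of_one_le_left (Real.exp_pos _).le h3
    · rw [indicator_of_notMem hxA]
      have : F x = 0 := by simpa [hA] using hxA
      rw [this, abs_zero, Real.zero_rpow (by linarith), mul_zero]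
  have hν0 : ν ≠ 0 := by
    intro h0
    obtain ⟨b, hb⟩ := hSb
    have : max b 0 + 1 ∈ S := by
      refine hmem _ (by positivity) ?_
      rw [h0]; simp [integrableExpSet]
    have h1 := hb this
    have h2 := le_max_left b 0
    linarith
  have hint : ∀ s : ℂ, s ≠ 0 →
      ∫ x, ((|f x| : ℝ) : ℂ) ^ s * (φ x : ℂ) = complexMGF L ν (-s) := by
    intro s hs
    rw [complexMGF, hν, integral_withDensity_eq_integral_smul hρm, ← integral_indicator hAm]
    congr 1
    ext1 x
    by_cases hxU : x ∈ U
    · by_cases hxA : x ∈ A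
      · rw [indicator_of_mem hxA, NNReal.smul_def, Real.coe_toNNReal _ (hφpos x)]
        have hfx : f x ≠ 0 := by rw [← hFU x hxU]; exact hxA
        rw [Complex.cpow_def_of_ne_zero (by simpa using hfx), Complex.real_smul, mul_comm,
          ← Complex.ofReal_log (abs_nonneg _)]
        congr 2
        simp only [hL, hFU x hxU]
        push_cast
        ring
      · rw [indicator_of_notMem hxA]
        have : f x = 0 := by rw [← hFU x hxU]; simpa [hA] using hxA
        rw [this, abs_zero, ofReal_zero, Complex.zero_cpow hs, zero_mul]
    · simp [hφU x hxU, indicator]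
  have hcW' : (c₀ : ℂ) ∈ (fun z : ℂ => -z) ⁻¹' W := by
    simpa using hcW
  obtain ⟨t, hct, ht⟩ := landau_mgf ν hν0 L hLm hL0 c₀ hc₀pos ((fun z : ℂ => -z) ⁻¹' W)
    (fun z => g (-z)) (hW.preimage continuous_neg) hcW'
    (by
      refine hg.comp differentiable_neg.differentiableOn ?_
      rintro z (hz | hz)
      · exact Or.inl hz
      · right
        simp only [mem_ofPred_eq, neg_re] at hz ⊢
        linarith)
    (by
      intro z hz hzc
      rw [hgeq (-z) (by simpa using hzc), hint (-z) (neg_ne_zero.mpr hz), neg_neg])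
  have := le_csSup hSb (hmem t (by linarith) ht)
  linarith
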